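/- Let A be a residuated lattice and F, G filters of A. Then F ∩ G = {1} and F ∨ G = A if and only if there exists e ∈ B(A) such that F = [e) and G = [¬e). -/

import Mathlib

/-- A (commutative integral bounded) residuated lattice: a bounded lattice together
with a commutative monoid structure (whose unit is the top element) and a residuum
operation satisfying the law of residuation. -/
class ResiduatedLattice (A : Type*) extends Lattice A, BoundedOrder A, CommMonoid A where
  rimp : A → A → A
  residuation : ∀ a b c : A, a ≤ rimp b c ↔ a * b ≤ c
  one_eq_top : (1 : A) = ⊤

namespace ResiduatedLattice

variable {A : Type*} [ResiduatedLattice A]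

/-- Negation: ¬a = a → 0. -/
def rneg (a : A) : A := rimp a ⊥

/-- Biresiduum: d(a,b) = (a → b) ∧ (b → a). -/
def bires (a b : A) : A := rimp a b ⊓ rimp b a

/-- Membership in the Boolean center B(A): complemented elements of the bounded lattice. -/
def IsBoolElem (e : A) : Prop := ∃ f : A, e ⊔ f = ⊤ ∧ e ⊓ f = ⊥

/-- A filter of a residuated lattice. -/
def IsRLFilter (F : Set A) : Prop :=
  F.Nonempty ∧ (∀ a b : A, a ∈ F → b ∈ F → a * b ∈ F) ∧ (∀ a b : A, a ∈ F → a ≤ b → b ∈ F)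

/-- The principal filter [x) = {a | xⁿ ≤ a for some n ≥ 1}. -/
def princ (x : A) : Set A := {a : A | ∃ n : ℕ, 1 ≤ n ∧ x ^ n ≤ a}

/-- A filter F has the Boolean Lifting Property. -/
def HasBLP (F : Set A) : Prop :=
  ∀ a : A, a ⊔ rneg a ∈ F → ∃ e : A, IsBoolElem e ∧ bires a e ∈ F

/-- A filter F has the Idempotent Lifting Property. -/
def HasILP (F : Set A) : Prop :=
  ∀ a : A, bires a (a * a) ∈ F → ∃ e : A, e * e = e ∧ bires a e ∈ F

/-- A proper filter. -/
def IsProperRLFilter (F : Set A) : Prop := IsRLFilter F ∧ F ≠ Set.univ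

/-- A maximal filter: a proper filter maximal under inclusion among proper filters. -/
def IsMaxRLFilter (M : Set A) : Prop :=
  IsProperRLFilter M ∧ ∀ G : Set A, IsProperRLFilter G → M ⊆ G → G = M

/-- A prime filter: a proper filter P with a ∨ b ∈ P → a ∈ P or b ∈ P. -/
def IsPrimeRLFilter (P : Set A) : Prop :=
  IsProperRLFilter P ∧ ∀ a b : A, a ⊔ b ∈ P → a ∈ P ∨ b ∈ P

/-- The radical: intersection of all maximal filters. -/
def rad (A : Type*) [ResiduatedLattice A] : Set A :=
  {a : A | ∀ M : Set A, IsMaxRLFilter M → a ∈ M}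

/-- v(a) = set of maximal filters containing a. -/
def vset (a : A) : Set (Set A) := {M : Set A | IsMaxRLFilter M ∧ a ∈ M}

/-- d(a) = set of maximal filters not containing a. -/
def dset (a : A) : Set (Set A) := {M : Set A | IsMaxRLFilter M ∧ a ∉ M}

/-- An element is nilpotent iff some positive power of it is 0. -/
def RLNilpotent (a : A) : Prop := ∃ n : ℕ, 1 ≤ n ∧ a ^ n = ⊥

/-- The join F ∨ G of two filters: the smallest filter including F ∪ G. -/
def filtJoin (F G : Set A) : Set A := ⋂₀ {H : Set A | IsRLFilter H ∧ F ∪ G ⊆ H}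

end ResiduatedLattice

namespace ResiduatedLattice

section Helpers

variable {A : Type*} [ResiduatedLattice A]

theorem mul_mono_right' {a b : A} (c : A) (h : a ≤ b) : a * c ≤ b * c :=
  (residuation a c (b * c)).1 (h.trans ((residuation b c (b * c)).2 le_rfl))

theorem mul_mono_both {a b c d : A} (h : a ≤ b) (k : c ≤ d) : a * c ≤ b * d := by
  refine (mul_mono_right' c h).trans ?_
  rw [mul_comm b c, mul_comm b d]
  exact mul_mono_right' b k

theorem le_one_all (a : A) : a ≤ 1 := by rw [one_eq_top]; exact le_top

theorem mul_le_l (a b : A) : a * b ≤ a := by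
  simpa using mul_mono_both (le_refl a) (le_one_all b)

theorem mul_le_r (a b : A) : a * b ≤ b := by
  rw [mul_comm]; exact mul_le_l b a

/-- Reasoning by cases along a cover of the unit. -/
theorem le_of_cover {x y a c : A} (h : x ⊔ y = ⊤) (hx : a * x ≤ c) (hy : a * y ≤ c) :
    a ≤ c := by
  have h1 : x ⊔ y ≤ rimp a c := sup_le ((residuation _ _ _).2 (by rwa [mul_comm]))
    ((residuation _ _ _).2 (by rwa [mul_comm]))
  rw [h, residuation, ← one_eq_top, one_mul] at h1
  exact h1

theorem rneg_eq_of_cover {e f : A} (h : e ⊔ f = ⊤) (h0 : e * f = ⊥) : rneg e = f := by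
  apply le_antisymm
  · refine le_of_cover h ?_ (mul_le_r _ _)
    exact ((residuation _ _ _).1 (le_refl (rimp e ⊥))).trans bot_le
  · exact (residuation _ _ _).2 (by rw [mul_comm, h0])

theorem pow_eq_of_cover {e f : A} (h : e ⊔ f = ⊤) (h0 : e * f = ⊥) (n : ℕ) : e ≤ e ^ n := by
  induction n with
  | zero => rw [pow_zero]; exact le_one_all e
  | succ k ih =>
    rw [pow_succ]
    exact le_of_cover h (mul_mono_right' e ih) (by rw [h0]; exact bot_le)

theorem mem_princ_of_cover {e f : A} (h : e ⊔ f = ⊤) (h0 : e * f = ⊥) (a : A) :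
    a ∈ princ e ↔ e ≤ a :=
  ⟨fun ⟨n, _, hn⟩ => (pow_eq_of_cover h h0 n).trans hn, fun h => ⟨1, le_rfl, by simpa using h⟩⟩

theorem join_bot {F G : Set A} (hF : IsRLFilter F) (hG : IsRLFilter G)
    (h : filtJoin F G = Set.univ) : ∃ f ∈ F, ∃ g ∈ G, f * g = ⊥ := by
  have hb : (⊥ : A) ∈ filtJoin F G := by rw [h]; trivial
  obtain ⟨⟨f0, hf0⟩, hFm, hFu⟩ := hF
  obtain ⟨⟨g0, hg0⟩, hGm, hGu⟩ := hG
  have := hb {a | ∃ f ∈ F, ∃ g ∈ G, f * g ≤ a} ⟨⟨⟨⊤, f0, hf0, g0, hg0, le_top⟩, ?_, ?_⟩, ?_⟩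
  · obtain ⟨f, hf, g, hg, hfg⟩ := this
    exact ⟨f, hf, g, hg, le_bot_iff.1 hfg⟩
  · rintro a b ⟨f, hf, g, hg, h1⟩ ⟨f', hf', g', hg', h2⟩
    refine ⟨f * f', hFm _ _ hf hf', g * g', hGm _ _ hg hg', ?_⟩
    rw [mul_mul_mul_comm]
    exact mul_mono_both h1 h2
  · rintro a b ⟨f, hf, g, hg, h1⟩ hab
    exact ⟨f, hf, g, hg, h1.trans hab⟩
  · rintro a (ha | ha)
    · exact ⟨a, ha, g0, hg0, mul_le_l _ _⟩
    · exact ⟨f0, hf0, a, ha, mul_le_r _ _⟩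

end Helpers

end ResiduatedLattice

open ResiduatedLattice in
theorem stmt_8 {A : Type*} [ResiduatedLattice A] (F G : Set A)
    (hF : IsRLFilter F) (hG : IsRLFilter G) :
    (F ∩ G = {(1 : A)} ∧ filtJoin F G = Set.univ) ↔
      (∃ e : A, IsBoolElem e ∧ F = princ e ∧ G = princ (rneg e)) := by
  constructor
  · rintro ⟨hI, hJ⟩
    obtain ⟨f, hf, g, hg, h0⟩ := join_bot hF hG hJ
    have hcov : ∀ a ∈ F, ∀ b ∈ G, a ⊔ b = ⊤ := by
      intro a ha b hb
      have h1 : a ⊔ b ∈ F ∩ G := ⟨hF.2.2 _ _ ha le_sup_left, hG.2.2 _ _ hb le_sup_right⟩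
      rw [hI] at h1
      rw [← one_eq_top]
      exact h1
    have hfg := hcov f hf g hg
    have h0' : g * f = ⊥ := by rw [mul_comm, h0]
    have hgf : g ⊔ f = ⊤ := by rw [sup_comm, hfg]
    refine ⟨f, ⟨g, hfg, ?_⟩, ?_, ?_⟩
    · rw [← le_bot_iff]
      refine le_of_cover hfg ?_ ?_
      · rw [← h0']
        exact mul_mono_right' f inf_le_right
      · rw [← h0]
        exact mul_mono_right' g inf_le_left
    · ext a
      rw [mem_princ_of_cover hfg h0]
      exact ⟨fun ha => le_of_cover (hcov a ha g hg) (mul_le_r _ _) (by rw [h0]; exact bot_le),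
        fun ha => hF.2.2 _ _ hf ha⟩
    · ext a
      rw [rneg_eq_of_cover hfg h0, mem_princ_of_cover hgf h0']
      exact ⟨fun ha => le_of_cover (hcov f hf a ha) (by rw [h0']; exact bot_le) (mul_le_r _ _),
        fun ha => hG.2.2 _ _ hg ha⟩
  · rintro ⟨e, ⟨f, hef, hi⟩, rfl, rfl⟩
    have h0 : e * f = ⊥ := by
      rw [← le_bot_iff, ← hi]
      exact le_inf (mul_le_l _ _) (mul_le_r _ _)
    have h0' : f * e = ⊥ := by rw [mul_comm, h0]
    have hfe : f ⊔ e = ⊤ := by rw [sup_comm, hef]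
    rw [rneg_eq_of_cover hef h0]
    constructor
    · ext a
      rw [Set.mem_inter_iff, mem_princ_of_cover hef h0, mem_princ_of_cover hfe h0',
        Set.mem_singleton_iff, ← sup_le_iff, hef, top_le_iff, one_eq_top]
    · ext a
      refine ⟨fun _ => trivial, ?_⟩
      rintro _ H ⟨hH, hs⟩
      have he : e ∈ H := hs (Or.inl ((mem_princ_of_cover hef h0 e).2 le_rfl))
      have hf : f ∈ H := hs (Or.inr ((mem_princ_of_cover hfe h0' f).2 le_rfl))
      have hb := hH.2.1 _ _ he hf
      rw [h0] at hb
      exact hH.2.2 _ _ hb bot_le
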